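/- (Lemma 2.3.2.) Let f ∈ C_c^∞(GL₂(k); ω) with W^f(1) = 0 (1 the identity matrix). Then there exist a function f₀ ∈ C_c^∞(GL₂(k); ω) which vanishes on every matrix of the form z·[[1,x],[0,1]] with z a scalar matrix and x ∈ k (i.e. f₀ vanishes on U_M·Z_M), and an integer κ₀, such that J_κ(n, f) = J_κ(n, f₀) for every admissible triple n = (x21, x31, x32) and every κ ≥ κ₀. -/

import Mathlib

open Matrix MeasureTheory

noncomputable section

variable (p : ℕ) [Fact p.Prime]

/-- The general element of the split Lie algebra of type `G₂`, realized as a `7 × 7` matrix. -/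
def Xmat (a b x01 x10 x11 x21 x31 x32 y01 y10 y11 y21 y31 y32 : ℚ_[p]) :
    Matrix (Fin 7) (Fin 7) ℚ_[p] :=
  !![a, x01, x32, 0, -x21, y10, 2*x11;
     y01, b, x31, x21, 0, -y11, 2*x10;
     y32, y31, -a-b, -y10, y11, 0, 2*y21;
     0, y21, -x10, -a, -y01, -y32, 2*y11;
     -y21, 0, x11, -x01, -b, -y31, 2*y10;
     x10, -x11, 0, -x32, -x31, a+b, 2*x21;
     y11, y10, x21, x11, x10, y21, 0]

/-- The exponential of a `7 × 7` matrix as a finite sum; for a nilpotent matrix this is the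
genuine exponential, since `A ^ 7 = 0`. -/
def mexp (A : Matrix (Fin 7) (Fin 7) ℚ_[p]) : Matrix (Fin 7) (Fin 7) ℚ_[p] :=
  ∑ i ∈ Finset.range 7, (Nat.factorial i : ℚ_[p])⁻¹ • A ^ i

/-- `Ē(y10, y11, y21, y31, y32)`: the exponential of the nilpotent element of `G₂` with lower
coordinates `y10, y11, y21, y31, y32` (and `y01 = 0`). -/
def Ebar (y10 y11 y21 y31 y32 : ℚ_[p]) : Matrix (Fin 7) (Fin 7) ℚ_[p] :=
  mexp p (Xmat p 0 0 0 0 0 0 0 0 0 y10 y11 y21 y31 y32)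

/-- The compact open subset `N̄_κ ⊂ N̄`: the set of `Ē(y10,y11,y21,y31,y32)` with
`v(y10) ≥ -κ²`, `v(y11) ≥ -κ`, `v(y21) ≥ -κ³`, `v(y31) ≥ -κ⁵`, `v(y32) ≥ -κ⁴`. -/
def NbarK (κ : ℕ) : Set (Matrix (Fin 7) (Fin 7) ℚ_[p]) :=
  {M | ∃ y10 y11 y21 y31 y32 : ℚ_[p],
    ‖y10‖ ≤ (p : ℝ)^(κ^2) ∧ ‖y11‖ ≤ (p : ℝ)^κ ∧ ‖y21‖ ≤ (p : ℝ)^(κ^3) ∧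
    ‖y31‖ ≤ (p : ℝ)^(κ^5) ∧ ‖y32‖ ≤ (p : ℝ)^(κ^4) ∧
    M = Ebar p y10 y11 y21 y31 y32}

/-- `φ_κ`, the characteristic function of `N̄_κ`, with values in `ℂ`. -/
def phiK (κ : ℕ) (M : Matrix (Fin 7) (Fin 7) ℚ_[p]) : ℂ :=
  letI := Classical.dec (M ∈ NbarK p κ)
  if M ∈ NbarK p κ then 1 else 0

/-- The embedding `GL₂ ↪ GL₇` realizing `GL₂` as the Levi subgroup `M ⊂ G₂`:
`A ↦ block-diag(A, (det A)⁻¹, ᵗA⁻¹, det A, 1)`. -/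
def iotaM (A : Matrix (Fin 2) (Fin 2) ℚ_[p]) : Matrix (Fin 7) (Fin 7) ℚ_[p] :=
  let a := A 0 0; let b := A 0 1; let c := A 1 0; let d := A 1 1
  let Δ := a*d - b*c
  !![a, b, 0, 0, 0, 0, 0;
     c, d, 0, 0, 0, 0, 0;
     0, 0, Δ⁻¹, 0, 0, 0, 0;
     0, 0, 0, Δ⁻¹*d, -(Δ⁻¹*c), 0, 0;
     0, 0, 0, -(Δ⁻¹*b), Δ⁻¹*a, 0, 0;
     0, 0, 0, 0, 0, Δ, 0;
     0, 0, 0, 0, 0, 0, 1]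

/-- The unipotent element `[[1, x], [0, 1]]` of `GL₂(ℚ_p)`. -/
def uu (x : ℚ_[p]) : GL (Fin 2) ℚ_[p] :=
  Matrix.GeneralLinearGroup.mkOfDetNeZero !![1, x; 0, 1] (by
    rw [Matrix.det_fin_two_of]; norm_num)

/-- The scalar (central) element `t·I₂` of `GL₂(ℚ_p)`, for `t ∈ ℚ_p^×`. -/
def scalGL (t : ℚ_[p]ˣ) : GL (Fin 2) ℚ_[p] :=
  Units.map (Matrix.scalar (Fin 2)).toMonoidHom t

/-- `f ∈ C_c^∞(GL₂(ℚ_p); ω)`: `f` is locally constant, transforms under the center by the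
character `ω`, and is compactly supported modulo the center. -/
def SmoothCptModZ (ω : ℚ_[p]ˣ → ℂ) (f : GL (Fin 2) ℚ_[p] → ℂ) : Prop :=
  IsLocallyConstant f ∧
  (∀ t : ℚ_[p]ˣ, ∀ g, f (scalGL p t * g) = ω t * f g) ∧
  ∃ C : Set (GL (Fin 2) ℚ_[p]), IsCompact C ∧
    ∀ g, f g ≠ 0 → ∃ t : ℚ_[p]ˣ, ∃ c ∈ C, g = scalGL p t * c

variable [MeasurableSpace ℚ_[p]]

/-- The Whittaker-type integral `W^f(m) = ∫_{U_M} f(x·m) ψ(x)⁻¹ dx`. -/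
def Wf (μ : Measure ℚ_[p]) (ψ : ℚ_[p] → ℂ) (f : GL (Fin 2) ℚ_[p] → ℂ)
    (m : GL (Fin 2) ℚ_[p]) : ℂ :=
  ∫ x, f (uu p x * m) * (ψ x)⁻¹ ∂μ

/-- `(x21, x31, x32)` is *admissible* if `x21 ≠ 0`, `x32 ≠ 0`, `D = x21² + x32 ≠ 0` and,
for the resulting `y`-coordinates, the Levi component `m = [[a,b],[c,d]]` has `c ≠ 0` and
`ad - bc ≠ 0`. -/
def y10v (n : ℚ_[p] × ℚ_[p] × ℚ_[p]) : ℚ_[p] := -n.2.2 / (n.1^2 + n.2.2)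
def y11v (n : ℚ_[p] × ℚ_[p] × ℚ_[p]) : ℚ_[p] := (-n.2.1 + (1/2)*n.1) / (n.1^2 + n.2.2)
def y21v (n : ℚ_[p] × ℚ_[p] × ℚ_[p]) : ℚ_[p] := -n.1 / (n.1^2 + n.2.2)
def y31v (n : ℚ_[p] × ℚ_[p] × ℚ_[p]) : ℚ_[p] := ((1/2)*n.2.2*n.1) / (n.1^2 + n.2.2)^2
def y32v (n : ℚ_[p] × ℚ_[p] × ℚ_[p]) : ℚ_[p] :=
  ((3/4)*n.1^2 + n.2.2 + (1/2)*n.1*n.2.1) / (n.1^2 + n.2.2)^2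
def av (n : ℚ_[p] × ℚ_[p] × ℚ_[p]) : ℚ_[p] := y10v p n * y11v p n + y21v p n
def bv (n : ℚ_[p] × ℚ_[p] × ℚ_[p]) : ℚ_[p] := (y10v p n)^2
def cv (n : ℚ_[p] × ℚ_[p] × ℚ_[p]) : ℚ_[p] :=
  -(y11v p n)^2 + (1/2)*y11v p n*y21v p n - y32v p n
def dv (n : ℚ_[p] × ℚ_[p] × ℚ_[p]) : ℚ_[p] :=
  -(1/2)*y10v p n*y11v p n + y21v p n - y31v p n

/-- Admissibility of a triple `(x21, x31, x32)`. -/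
def Adm (n : ℚ_[p] × ℚ_[p] × ℚ_[p]) : Prop :=
  n.1 ≠ 0 ∧ n.2.2 ≠ 0 ∧ n.1^2 + n.2.2 ≠ 0 ∧ cv p n ≠ 0 ∧
    av p n * dv p n - bv p n * cv p n ≠ 0

/-- The Levi component `m(n) = [[a,b],[c,d]] ∈ GL₂(ℚ_p)` of an admissible triple. -/
def mGL (n : ℚ_[p] × ℚ_[p] × ℚ_[p]) (h : Adm p n) : GL (Fin 2) ℚ_[p] :=
  Matrix.GeneralLinearGroup.mkOfDetNeZero !![av p n, bv p n; cv p n, dv p n] (by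
    rw [Matrix.det_fin_two_of]; exact h.2.2.2.2)

/-- `n̄(n) ∈ GL₇(ℚ_p)`, the opposite-unipotent component of the decomposition
`ẇ₀⁻¹·E(1,0,x21,x31,x32) = m(n)·n'·n̄(n)`. -/
def nbarM (n : ℚ_[p] × ℚ_[p] × ℚ_[p]) : Matrix (Fin 7) (Fin 7) ℚ_[p] :=
  Ebar p (y10v p n) (y11v p n) (y21v p n) (y31v p n) (y32v p n)

/-- The partial Bessel function
`J_κ(n, f) = ∫_{U_M} W^f(m(n)·u) φ_κ(u·n̄(n)·u⁻¹) ψ(u)⁻¹ du`, the conjugation being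
computed in `GL₇(ℚ_p)` via the embedding `ι`. -/
def Jk (μ : Measure ℚ_[p]) (ψ : ℚ_[p] → ℂ) (κ : ℕ)
    (n : ℚ_[p] × ℚ_[p] × ℚ_[p]) (h : Adm p n) (f : GL (Fin 2) ℚ_[p] → ℂ) : ℂ :=
  ∫ x, Wf p μ ψ f (mGL p n h * uu p x) *
    phiK p κ (iotaM p (uu p x).val * nbarM p n * (iotaM p (uu p x).val)⁻¹) *
    (ψ x)⁻¹ ∂μ

section Helpers

variable {p}

omit [MeasurableSpace ℚ_[p]] in
lemma padic_norm_sub_le_max (x y : ℚ_[p]) : ‖x - y‖ ≤ max ‖x‖ ‖y‖ := by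
  simpa [sub_eq_add_neg] using IsUltrametricDist.norm_add_le_max x (-y)

omit [MeasurableSpace ℚ_[p]] in
lemma uu_add (x y : ℚ_[p]) : uu p (x + y) = uu p x * uu p y := by
  ext i j
  fin_cases i <;> fin_cases j <;>
    simp [uu, Matrix.GeneralLinearGroup.mkOfDetNeZero, Matrix.mul_apply, add_comm]

omit [MeasurableSpace ℚ_[p]] in
lemma uu_zero : uu p 0 = 1 := by
  ext i j
  fin_cases i <;> fin_cases j <;> simp [uu, Matrix.GeneralLinearGroup.mkOfDetNeZero]

omit [MeasurableSpace ℚ_[p]] in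
lemma uu_neg_mul (x : ℚ_[p]) : uu p (-x) * uu p x = 1 := by
  rw [← uu_add, neg_add_cancel, uu_zero]

omit [MeasurableSpace ℚ_[p]] in
lemma continuous_uu : Continuous (uu p) := by
  have hval : Continuous fun x : ℚ_[p] => (uu p x).val := by
    refine continuous_matrix fun i j => ?_
    fin_cases i <;> fin_cases j <;>
      simp [uu, Matrix.GeneralLinearGroup.mkOfDetNeZero] <;> fun_prop
  refine Units.continuous_iff.2 ⟨hval, ?_⟩
  have hinv : ∀ x, (uu p x)⁻¹ = uu p (-x) := fun x =>
    (eq_inv_of_mul_eq_one_left (uu_neg_mul x)).symm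
  simp only [hinv]
  exact hval.comp continuous_neg

omit [MeasurableSpace ℚ_[p]] in
lemma scalGL_mul_comm (t : ℚ_[p]ˣ) (g : GL (Fin 2) ℚ_[p]) :
    scalGL p t * g = g * scalGL p t := by
  apply Units.ext
  exact Matrix.scalar_commute t.val (fun _ => mul_comm _ _) g.val

omit [MeasurableSpace ℚ_[p]] in
/-- If `f` is compactly supported modulo the center, then each `x ↦ f (u(x) m)` has bounded
support. -/
lemma exists_norm_le_of_apply_uu_mul_ne_zero {ω : ℚ_[p]ˣ → ℂ} {f : GL (Fin 2) ℚ_[p] → ℂ}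
    (hf : SmoothCptModZ p ω f) (m : GL (Fin 2) ℚ_[p]) :
    ∃ R : ℝ, 0 < R ∧ ∀ x, f (uu p x * m) ≠ 0 → ‖x‖ ≤ R := by
  obtain ⟨-, -, C, hC, hsupp⟩ := hf
  have hcont : Continuous fun c : GL (Fin 2) ℚ_[p] =>
      m.val.det * (c⁻¹).val.det * ((c * m⁻¹).val 0 1) ^ 2 := by
    have h₁ : Continuous fun c : GL (Fin 2) ℚ_[p] => (c⁻¹).val.det :=
      (Units.continuous_val.comp continuous_inv).matrix_det
    have h₂ : Continuous fun c : GL (Fin 2) ℚ_[p] => (c * m⁻¹).val 0 1 :=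
      (Units.continuous_val.comp (continuous_mul_const _)).matrix_elem 0 1
    fun_prop
  obtain ⟨K, hK⟩ := (hC.image hcont).isBounded.exists_norm_le
  refine ⟨max K 1, by positivity, fun x hx => ?_⟩
  obtain ⟨t, c, hc, h⟩ := hsupp _ hx
  have hu : uu p x = scalGL p t * (c * m⁻¹) := by
    rw [← mul_assoc, ← h, mul_inv_cancel_right]
  have hx01 : x = t.val * (c * m⁻¹).val 0 1 := by
    have := congrArg (fun g : GL (Fin 2) ℚ_[p] => g.val 0 1) hu
    simpa [uu, scalGL, Matrix.GeneralLinearGroup.mkOfDetNeZero] using this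
  have hdet : m.val.det = t.val ^ 2 * c.val.det := by
    have := congrArg (fun g : GL (Fin 2) ℚ_[p] => g.val.det) h
    have hone : (uu p x).val.det = 1 := by
      simp [uu, Matrix.GeneralLinearGroup.mkOfDetNeZero]
    have hscal : (scalGL p t).val.det = t.val ^ 2 := by
      simp [scalGL, pow_two]
    simpa only [Units.val_mul, Matrix.det_mul, hone, one_mul, hscal] using this
  have hcdet : c.val.det * (c⁻¹).val.det = 1 := by
    rw [← Matrix.det_mul, ← Units.val_mul, mul_inv_cancel, Units.val_one, Matrix.det_one]
  have hsq : x ^ 2 = m.val.det * (c⁻¹).val.det * ((c * m⁻¹).val 0 1) ^ 2 := by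
    rw [hdet, mul_assoc (t.val ^ 2), hcdet, mul_one, ← mul_pow, ← hx01]
  have hle : ‖x‖ ^ 2 ≤ K := by
    rw [← norm_pow, hsq]
    exact hK _ ⟨c, hc, rfl⟩
  by_contra! hlt
  obtain ⟨h₁, h₂⟩ := max_lt_iff.1 hlt
  nlinarith

/-- The average of `f` against `ψ⁻¹` over left translates by `u(y)` with `‖y‖ ≤ R`. -/
def unipotentAverage (μ : Measure ℚ_[p]) (ψ : ℚ_[p] → ℂ) (R : ℝ)
    (f : GL (Fin 2) ℚ_[p] → ℂ) (g : GL (Fin 2) ℚ_[p]) : ℂ :=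
  (μ.real (Metric.closedBall 0 R) : ℂ)⁻¹ *
    ∫ y in Metric.closedBall 0 R, f (uu p y * g) * (ψ y)⁻¹ ∂μ

lemma smoothCptModZ_unipotentAverage [BorelSpace ℚ_[p]] (μ : Measure ℚ_[p]) (ψ : ℚ_[p] → ℂ)
    (R : ℝ) {ω : ℚ_[p]ˣ → ℂ} {f : GL (Fin 2) ℚ_[p] → ℂ} (hf : SmoothCptModZ p ω f) :
    SmoothCptModZ p ω (unipotentAverage μ ψ R f) := by
  obtain ⟨hlc, hω, C, hC, hsupp⟩ := hf
  have hB : IsCompact (Metric.closedBall (0 : ℚ_[p]) R) := isCompact_closedBall 0 R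
  refine ⟨(IsLocallyConstant.iff_eventually_eq _).2 fun g => ?_, fun t g => ?_,
    (fun q : ℚ_[p] × GL (Fin 2) ℚ_[p] => uu p (-q.1) * q.2) '' (Metric.closedBall 0 R ×ˢ C),
    (hB.prod hC).image ((continuous_uu.comp continuous_fst.neg).mul continuous_snd),
    fun g hg => ?_⟩
  · have hmul : Continuous fun q : GL (Fin 2) ℚ_[p] × ℚ_[p] => uu p q.2 * q.1 :=
      (continuous_uu.comp continuous_snd).mul continuous_fst
    have hnear : ∀ y ∈ Metric.closedBall (0 : ℚ_[p]) R,
        ∀ᶠ q : GL (Fin 2) ℚ_[p] × ℚ_[p] in nhds (g, y),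
          f (uu p q.2 * q.1) = f (uu p q.2 * g) := by
      intro y _
      have h₁ := (hlc.comp_continuous hmul).eventually_eq (g, y)
      have h₂ := (hlc.comp_continuous
        ((continuous_uu.comp continuous_snd).mul
        (continuous_const (y := g)))).eventually_eq (g, y)
      filter_upwards [h₁, h₂] with q hq₁ hq₂
      exact hq₁.trans hq₂.symm
    filter_upwards [hB.eventually_forall_of_forall_eventually
      (P := fun g' y => f (uu p y * g') = f (uu p y * g)) hnear] with g' hg'
    unfold unipotentAverage
    congr 1
    exact setIntegral_congr_fun Metric.isClosed_closedBall.measurableSet fun y hy => by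
      simp only [hg' y hy]
  · have hcomm : ∀ y, uu p y * (scalGL p t * g) = scalGL p t * (uu p y * g) := fun y => by
      rw [← mul_assoc, ← scalGL_mul_comm, mul_assoc]
    simp only [unipotentAverage, hcomm, hω, mul_assoc, integral_const_mul]
    ring
  · obtain ⟨y, hy, hne⟩ : ∃ y ∈ Metric.closedBall (0 : ℚ_[p]) R, f (uu p y * g) ≠ 0 := by
      by_contra! h
      refine hg ?_
      rw [unipotentAverage, setIntegral_eq_zero_of_forall_eq_zero, mul_zero]
      intro y hy
      rw [h y hy, zero_mul]
    obtain ⟨t, c, hc, h⟩ := hsupp _ hne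
    refine ⟨t, _, ⟨(y, c), ⟨hy, hc⟩, rfl⟩, ?_⟩
    rw [← mul_assoc, scalGL_mul_comm, mul_assoc, ← h, ← mul_assoc, uu_neg_mul, one_mul]

lemma unipotentAverage_uu [BorelSpace ℚ_[p]] (μ : Measure ℚ_[p]) [μ.IsAddHaarMeasure]
    {ψ : ℚ_[p] → ℂ} (hψadd : ∀ x y, ψ (x + y) = ψ x * ψ y) (hψne : ∀ x, ψ x ≠ 0)
    {R : ℝ} {f : GL (Fin 2) ℚ_[p] → ℂ} (hR : ∀ x, f (uu p x) ≠ 0 → ‖x‖ ≤ R)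
    (hW : Wf p μ ψ f 1 = 0) (x : ℚ_[p]) :
    unipotentAverage μ ψ R f (uu p x) = 0 := by
  unfold unipotentAverage
  simp only [← uu_add]
  by_cases hx : ‖x‖ ≤ R
  · rw [setIntegral_eq_integral_of_forall_compl_eq_zero]
    · have h : ∀ y, f (uu p (y + x)) * (ψ y)⁻¹ =
          ψ x * (fun z => f (uu p z) * (ψ z)⁻¹) (y + x) := by
        intro y
        have := hψne x
        have := hψne y
        simp only [hψadd]
        field_simp
      simp only [Wf, mul_one] at hW
      simp_rw [h]
      rw [integral_const_mul, integral_add_right_eq_self (fun z => f (uu p z) * (ψ z)⁻¹) x, hW]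
      simp
    · intro y hy
      have hne : f (uu p (y + x)) = 0 := by
        by_contra hne
        refine hy (mem_closedBall_zero_iff.2 ?_)
        calc ‖y‖ = ‖(y + x) - x‖ := by rw [add_sub_cancel_right]
          _ ≤ max ‖y + x‖ ‖x‖ := padic_norm_sub_le_max _ _
          _ ≤ R := max_le (hR _ hne) hx
      rw [hne, zero_mul]
  · rw [setIntegral_eq_zero_of_forall_eq_zero, mul_zero]
    intro y hy
    have hne : f (uu p (y + x)) = 0 := by
      by_contra hne
      refine hx ?_
      calc ‖x‖ = ‖(y + x) - y‖ := by rw [add_sub_cancel_left]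
        _ ≤ max ‖y + x‖ ‖y‖ := padic_norm_sub_le_max _ _
        _ ≤ R := max_le (hR _ hne) (mem_closedBall_zero_iff.1 hy)
    rw [hne, zero_mul]

/-- Averaging over left translates by a compact open subgroup of the unipotent radical does not
change the Whittaker integral. -/
lemma Wf_unipotentAverage [BorelSpace ℚ_[p]] (μ : Measure ℚ_[p]) [μ.IsAddHaarMeasure]
    {ψ : ℚ_[p] → ℂ} (hψcont : Continuous ψ) (hψadd : ∀ x y, ψ (x + y) = ψ x * ψ y)
    (hψne : ∀ x, ψ x ≠ 0) {R : ℝ} (hR : 0 < R) {ω : ℚ_[p]ˣ → ℂ}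
    {f : GL (Fin 2) ℚ_[p] → ℂ} (hf : SmoothCptModZ p ω f) (m : GL (Fin 2) ℚ_[p]) :
    Wf p μ ψ (unipotentAverage μ ψ R f) m = Wf p μ ψ f m := by
  obtain ⟨S, -, hS⟩ := exists_norm_le_of_apply_uu_mul_ne_zero hf m
  set B := Metric.closedBall (0 : ℚ_[p]) R with hBdef
  have hBclopen : IsClopen B := IsUltrametricDist.isClopen_closedBall 0 hR.ne'
  have hBmeas : MeasurableSet B := hBclopen.isClosed.measurableSet
  have hBpos : (μ.real B : ℂ) ≠ 0 := by
    have h₁ : μ B ≠ 0 := (Metric.measure_closedBall_pos μ 0 hR).ne'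
    have h₂ : μ B ≠ ⊤ := (isCompact_closedBall 0 R).measure_lt_top.ne
    exact_mod_cast ENNReal.toReal_ne_zero.2 ⟨h₁, h₂⟩
  set H : ℚ_[p] → ℂ := fun x => f (uu p x * m) * (ψ x)⁻¹ with hH
  have hHcont : Continuous H :=
    (hf.1.continuous.comp (continuous_uu.mul continuous_const)).mul (hψcont.inv₀ hψne)
  set F : ℚ_[p] → ℚ_[p] → ℂ := fun x y => B.indicator (fun y => H (x + y)) y with hF
  have hFcont : Continuous (Function.uncurry F) := by
    have hBc : IsClopen (Prod.snd ⁻¹' B : Set (ℚ_[p] × ℚ_[p])) :=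
      hBclopen.preimage continuous_snd
    have : Function.uncurry F =
        (Prod.snd ⁻¹' B).indicator fun q : ℚ_[p] × ℚ_[p] => H (q.1 + q.2) := by
      ext ⟨x, y⟩
      rfl
    rw [this]
    exact (hHcont.comp (continuous_fst.add continuous_snd)).indicator
      (by simp [hBc.frontier_eq])
  have hFsupp : HasCompactSupport (Function.uncurry F) := by
    refine HasCompactSupport.of_support_subset_isCompact
      ((isCompact_closedBall (0 : ℚ_[p]) (max S R)).prod (isCompact_closedBall 0 R)) ?_
    rintro ⟨x, y⟩ hxy
    have hy : y ∈ B := by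
      by_contra hy
      exact hxy (Set.indicator_of_notMem hy fun y => H (x + y))
    refine ⟨mem_closedBall_zero_iff.2 ?_, hy⟩
    have hne : H (x + y) ≠ 0 := by
      simpa [hF, Function.uncurry, Set.indicator_of_mem hy] using hxy
    calc ‖x‖ = ‖(x + y) - y‖ := by rw [add_sub_cancel_right]
      _ ≤ max ‖x + y‖ ‖y‖ := padic_norm_sub_le_max _ _
      _ ≤ max S R := max_le_max (hS _ (left_ne_zero_of_mul hne)) (mem_closedBall_zero_iff.1 hy)
  have hinner : ∀ x, unipotentAverage μ ψ R f (uu p x * m) * (ψ x)⁻¹ =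
      (μ.real B : ℂ)⁻¹ * ∫ y, F x y ∂μ := by
    intro x
    rw [unipotentAverage, mul_assoc, ← integral_mul_const, hF, integral_indicator hBmeas]
    congr 2
    ext y
    simp only [hH]
    rw [hψadd, add_comm x y, uu_add, mul_inv, mul_assoc (uu p y)]
    ring
  have houter : ∀ y, ∫ x, F x y ∂μ = B.indicator (fun _ => Wf p μ ψ f m) y := by
    intro y
    by_cases hy : y ∈ B
    · simp only [hF, Set.indicator_of_mem hy]
      exact integral_add_right_eq_self H y
    · simp [hF, Set.indicator_of_notMem hy]
  unfold Wf at houter ⊢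
  simp_rw [hinner]
  rw [integral_const_mul, integral_integral_swap_of_hasCompactSupport hFcont hFsupp]
  simp_rw [houter]
  rw [integral_indicator hBmeas, setIntegral_const, Complex.real_smul, inv_mul_cancel_left₀ hBpos]

end Helpers

/-- Lemma 2.3.2: if `f ∈ C_c^∞(GL₂(k); ω)` satisfies `W^f(1) = 0`, then there are an
`f₀ ∈ C_c^∞(GL₂(k); ω)` vanishing on `U_M · Z_M` (i.e. on all `z·[[1,x],[0,1]]` with `z`
scalar) and an integer `κ₀` such that `J_κ(n, f) = J_κ(n, f₀)` for every admissible triple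
`n` and every `κ ≥ κ₀`. -/
theorem bessel_move_off_center [BorelSpace ℚ_[p]]
    (μ : Measure ℚ_[p]) [μ.IsAddHaarMeasure]
    (ψ : ℚ_[p] → ℂ) (hψcont : Continuous ψ)
    (hψadd : ∀ x y, ψ (x + y) = ψ x * ψ y)
    (hψnorm : ∀ x, ‖ψ x‖ = 1) (hψnt : ∃ x, ψ x ≠ 1)
    (ω : ℚ_[p]ˣ → ℂ) (hωmul : ∀ s t, ω (s * t) = ω s * ω t)
    (hωlc : IsLocallyConstant ω)
    (f : GL (Fin 2) ℚ_[p] → ℂ) (hf : SmoothCptModZ p ω f)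
    (hW : Wf p μ ψ f 1 = 0) :
    ∃ f₀ : GL (Fin 2) ℚ_[p] → ℂ, SmoothCptModZ p ω f₀ ∧
      (∀ t : ℚ_[p]ˣ, ∀ x : ℚ_[p], f₀ (scalGL p t * uu p x) = 0) ∧
      ∃ κ₀ : ℕ, ∀ κ : ℕ, κ₀ ≤ κ → ∀ n : ℚ_[p] × ℚ_[p] × ℚ_[p], ∀ h : Adm p n,
        Jk p μ ψ κ n h f = Jk p μ ψ κ n h f₀ := by
  have hψne : ∀ x, ψ x ≠ 0 := fun x hx => by simpa [hx] using hψnorm x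
  obtain ⟨R, hR, hsupp⟩ := exists_norm_le_of_apply_uu_mul_ne_zero hf 1
  simp only [mul_one] at hsupp
  have havg := smoothCptModZ_unipotentAverage μ ψ R hf
  refine ⟨unipotentAverage μ ψ R f, havg, fun t x => ?_, 0, fun κ _ n h => ?_⟩
  · rw [havg.2.1, unipotentAverage_uu μ hψadd hψne hsupp hW, mul_zero]
  · simp only [Jk, Wf_unipotentAverage μ hψcont hψadd hψne hR hf]

end
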